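/- arXiv:2603.23035 — 3 statements merged into one kernel-verified Lean document; each statement's English description precedes it below -/
import Mathlib

section
/- Let (Ω, μ) be a finite measure space, T > 0, and let u ∈ H¹(0,T;L²(μ)) with time derivative v. Let φ : ℝ → ℝ be a non-decreasing, bounded, Lipschitz-continuous function with φ(0) = 0, and set ψ(s) = ∫₀ˢ φ(σ) dσ. Then for all 0 ≤ s ≤ t ≤ T one has ∫_Ω ψ(u(t)) dμ − ∫_Ω ψ(u(s)) dμ = ∫_s^t ( ∫_Ω φ(u(σ)) · v(σ) dμ ) dσ; equivalently, the function t ↦ ∫_Ω ψ(u(t)) dμ has (∫_Ω φ(u(t)) v(t) dμ) as its derivative for almost every t ∈ (0,T). -/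
open MeasureTheory intervalIntegral

open scoped NNReal

/-- Post-composing an absolutely continuous function with a Lipschitz map preserves absolute
continuity. -/
theorem LipschitzWith.comp_absolutelyContinuousOnInterval {X Y : Type*} [PseudoMetricSpace X]
    [PseudoMetricSpace Y] {K : ℝ≥0} {g : X → Y} (hg : LipschitzWith K g) {f : ℝ → X} {a b : ℝ}
    (hf : AbsolutelyContinuousOnInterval f a b) :
    AbsolutelyContinuousOnInterval (g ∘ f) a b := by
  have h := Filter.Tendsto.const_mul (K : ℝ) hf
  rw [mul_zero] at h
  refine squeeze_zero (fun E => Finset.sum_nonneg fun i _ => dist_nonneg) (fun E => ?_) h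
  rw [Finset.mul_sum]
  exact Finset.sum_le_sum fun i _ => hg.dist_le_mul _ _

theorem AbsolutelyContinuousOnInterval.of_dist_le {X Y : Type*} [PseudoMetricSpace X]
    [PseudoMetricSpace Y] {f : ℝ → X} {g : ℝ → Y} {a b : ℝ}
    (hg : AbsolutelyContinuousOnInterval g a b)
    (h : ∀ x ∈ Set.uIcc a b, ∀ y ∈ Set.uIcc a b, dist (f x) (f y) ≤ dist (g x) (g y)) :
    AbsolutelyContinuousOnInterval f a b := by
  refine squeeze_zero' (.of_forall fun E => Finset.sum_nonneg fun i _ => dist_nonneg) ?_ hg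
  filter_upwards [Filter.mem_inf_of_right (Filter.mem_principal_self _)] with E hE
  exact Finset.sum_le_sum fun i hi => h _ (hE.1 i hi).1 _ (hE.1 i hi).2

/-- The Bochner integral as a function of its upper endpoint is absolutely continuous. -/
theorem IntervalIntegrable.absolutelyContinuousOnInterval_const_add_integral {E : Type*}
    [NormedAddCommGroup E] [NormedSpace ℝ E] {f : ℝ → E} {a b : ℝ}
    (hf : IntervalIntegrable f volume a b) (e : E) :
    AbsolutelyContinuousOnInterval (fun x => e + ∫ s in a..x, f s) a b := by
  refine (hf.norm.absolutelyContinuousOnInterval_intervalIntegral Set.left_mem_uIcc).of_dist_le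
    fun x hx y hy => ?_
  have hax := hf.mono_set (Set.uIcc_subset_uIcc_left hx)
  have hay := hf.mono_set (Set.uIcc_subset_uIcc_left hy)
  rw [dist_add_left, dist_eq_norm, dist_eq_norm, integral_interval_sub_left hax hay,
    integral_interval_sub_left hax.norm hay.norm]
  exact norm_integral_le_abs_integral_norm

section Primitive

variable {φ ψ : ℝ → ℝ}

theorem sub_eq_integral_of_primitive (hφ : Continuous φ)
    (hψ : ∀ s : ℝ, ψ s = ∫ σ in (0 : ℝ)..s, φ σ) (a b : ℝ) : ψ b - ψ a = ∫ σ in a..b, φ σ := by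
  rw [hψ, hψ]
  exact integral_interval_sub_left (hφ.intervalIntegrable _ _) (hφ.intervalIntegrable _ _)

theorem lipschitzWith_of_primitive {M : ℝ≥0} (hφ : Continuous φ) (hM : ∀ s, |φ s| ≤ M)
    (hψ : ∀ s : ℝ, ψ s = ∫ σ in (0 : ℝ)..s, φ σ) : LipschitzWith M ψ := by
  refine LipschitzWith.of_dist_le_mul fun b a => ?_
  rw [Real.dist_eq, sub_eq_integral_of_primitive hφ hψ, Real.dist_eq]
  exact intervalIntegral.norm_integral_le_of_norm_le_const (f := φ) fun x _ => hM x

/-- A primitive of an `L`-Lipschitz function has a quadratic first order remainder. -/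
theorem abs_primitive_sub_sub_le {L : ℝ≥0} (hφ : LipschitzWith L φ)
    (hψ : ∀ s : ℝ, ψ s = ∫ σ in (0 : ℝ)..s, φ σ) (a b : ℝ) :
    |ψ b - ψ a - φ a * (b - a)| ≤ L * (b - a) ^ 2 := by
  have h : ψ b - ψ a - φ a * (b - a) = ∫ σ in a..b, (φ σ - φ a) := by
    rw [integral_sub (hφ.continuous.intervalIntegrable _ _) intervalIntegrable_const,
      sub_eq_integral_of_primitive hφ.continuous hψ, intervalIntegral.integral_const, smul_eq_mul, mul_comm (b - a)]
  rw [h, ← sq_abs (b - a), sq, ← mul_assoc]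
  refine intervalIntegral.norm_integral_le_of_norm_le_const (f := fun σ => φ σ - φ a)
    fun x hx => ?_
  refine (hφ.dist_le_mul x a).trans ?_
  gcongr
  exact Set.abs_sub_left_of_mem_uIcc (Set.uIoc_subset_uIcc hx)

variable {Ω : Type*} [MeasurableSpace Ω] {μ : Measure Ω} [IsFiniteMeasure μ]

/-- The integral functional of a Lipschitz function vanishing at `0` is Lipschitz on `L²`. -/
theorem LipschitzWith.exists_lipschitzWith_integral_comp {M : ℝ≥0} (hψ : LipschitzWith M ψ)
    (hψ0 : ψ 0 = 0) : ∃ K : ℝ≥0, LipschitzWith K fun w : Lp ℝ 2 μ => ∫ x, ψ (w x) ∂μ := by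
  let c : Lp ℝ 2 μ := Lp.const 2 μ 1
  have h (w : Lp ℝ 2 μ) : innerSL ℝ c (hψ.compLp hψ0 w) = ∫ x, ψ (w x) ∂μ := by
    rw [innerSL_apply_apply, L2.inner_def]
    refine MeasureTheory.integral_congr_ae ?_
    filter_upwards [hψ.coeFn_compLp hψ0 w, Lp.coeFn_const (p := 2) (μ := μ) (1 : ℝ)] with x h1 h2
    rw [h1, h2]
    simp
  refine ⟨‖innerSL ℝ c‖₊ * M, ?_⟩
  simpa only [Function.comp_def, h] using
    (innerSL ℝ c).lipschitz.comp (hψ.lipschitzWith_compLp (p := 2) (μ := μ) hψ0)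

/-- The integral functional of a primitive of a Lipschitz function is Fréchet differentiable
on `L²`. -/
theorem LipschitzWith.hasFDerivAt_integral_primitive {L M : ℝ≥0} (hφ : LipschitzWith L φ)
    (hφ0 : φ 0 = 0) (hM : ∀ s, |φ s| ≤ M) (hψ : ∀ s : ℝ, ψ s = ∫ σ in (0 : ℝ)..s, φ σ)
    (w : Lp ℝ 2 μ) :
    HasFDerivAt (fun w : Lp ℝ 2 μ => ∫ x, ψ (w x) ∂μ) (innerSL ℝ (hφ.compLp hφ0 w)) w := by
  have hψL := lipschitzWith_of_primitive hφ.continuous hM hψ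
  have hψ0 : ψ 0 = 0 := by rw [hψ, integral_same]
  have hint (f : Lp ℝ 2 μ) : Integrable (fun x => ψ (f x)) μ :=
    (hψL.comp_memLp hψ0 (Lp.memLp f)).integrable (by norm_num)
  have hbound (f : Lp ℝ 2 μ) : ‖(∫ x, ψ (f x) ∂μ) - (∫ x, ψ (w x) ∂μ) -
      innerSL ℝ (hφ.compLp hφ0 w) (f - w)‖ ≤ L * ‖f - w‖ ^ 2 := by
    rw [innerSL_apply_apply, ← MeasureTheory.integral_sub (hint f) (hint w), L2.inner_def,
      ← MeasureTheory.integral_sub (f := fun x => ψ (f x) - ψ (w x)) ((hint f).sub (hint w)) (L2.integrable_inner _ _),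
      ← real_inner_self_eq_norm_sq, L2.inner_def, ← MeasureTheory.integral_const_mul]
    refine norm_integral_le_of_norm_le ((L2.integrable_inner _ _).const_mul _) ?_
    filter_upwards [hφ.coeFn_compLp hφ0 w, Lp.coeFn_sub f w] with x h1 h2
    rw [h1, h2]
    simpa [mul_comm, sq] using abs_primitive_sub_sub_le hφ hψ (w x) (f x)
  refine .of_isLittleO ?_
  refine (Asymptotics.IsBigO.of_bound (g := fun f => ‖f - w‖ ^ 2) L
    (Filter.Eventually.of_forall fun f => ?_)).trans_isLittleO
    (Asymptotics.isLittleO_pow_sub_sub w one_lt_two)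
  simpa using hbound f

end Primitive

/-- Chain rule for the time derivative. Let `(Ω, μ)` be a finite
measure space, `T > 0`, and `u ∈ H¹(0,T;L²(μ))` with time derivative `v`, i.e.
`v` is strongly measurable with `∫₀ᵀ ‖v(s)‖² ds < ∞` and
`u(t) = u(0) + ∫₀ᵗ v(s) ds` (Bochner integral in `L²(μ)`) for `t ∈ [0,T]`.
Let `φ : ℝ → ℝ` be non-decreasing, bounded, Lipschitz with `φ(0) = 0`, and let
`ψ(s) = ∫₀ˢ φ(σ) dσ`. Then for all `0 ≤ s ≤ t ≤ T`,
`∫ ψ(u(t)) dμ − ∫ ψ(u(s)) dμ = ∫ₛᵗ (∫ φ(u(σ)) v(σ) dμ) dσ`. -/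
theorem stmt0 {Ω : Type*} [MeasurableSpace Ω] (μ : Measure Ω) [IsFiniteMeasure μ]
    (T : ℝ) (hT : 0 < T)
    (u v : ℝ → Lp ℝ 2 μ)
    (hv_meas : StronglyMeasurable v)
    (hv_int : IntegrableOn (fun s => ‖v s‖ ^ 2) (Set.Icc 0 T))
    (hu : ∀ t ∈ Set.Icc (0:ℝ) T, u t = u 0 + ∫ s in (0:ℝ)..t, v s)
    (φ ψ : ℝ → ℝ)
    (hφ_mono : Monotone φ) (hφ_bdd : ∃ M : ℝ, ∀ s : ℝ, |φ s| ≤ M)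
    (hφ_lip : ∃ L : NNReal, LipschitzWith L φ) (hφ0 : φ 0 = 0)
    (hψ : ∀ s : ℝ, ψ s = ∫ σ in (0:ℝ)..s, φ σ) :
    ∀ s t : ℝ, 0 ≤ s → s ≤ t → t ≤ T →
      (∫ x, ψ (u t x) ∂μ) - (∫ x, ψ (u s x) ∂μ) =
        ∫ σ in s..t, ∫ x, φ (u σ x) * v σ x ∂μ := by
  intro s t hs hst htT
  obtain ⟨M, hM⟩ := hφ_bdd
  lift M to ℝ≥0 using (abs_nonneg (φ 0)).trans (hM 0)
  obtain ⟨L, hL⟩ := hφ_lip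
  have hψ0 : ψ 0 = 0 := by rw [hψ, integral_same]
  obtain ⟨K, hK⟩ := (lipschitzWith_of_primitive hL.continuous hM hψ
    ).exists_lipschitzWith_integral_comp (μ := μ) hψ0
  have hv : IntervalIntegrable v volume 0 T := by
    rw [intervalIntegrable_iff_integrableOn_Icc_of_le hT.le]
    exact ((memLp_two_iff_integrable_sq_norm hv_meas.aestronglyMeasurable).2 hv_int).integrable
      one_le_two
  let U : ℝ → Lp ℝ 2 μ := fun r => u 0 + ∫ σ in (0 : ℝ)..r, v σ
  have hst_sub : Set.uIcc s t ⊆ Set.uIcc 0 T := by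
    rw [Set.uIcc_of_le hst, Set.uIcc_of_le hT.le]
    exact Set.Icc_subset_Icc hs htT
  have hU : AbsolutelyContinuousOnInterval U s t :=
    (hv.absolutelyContinuousOnInterval_const_add_integral (u 0)).mono hst_sub
  have hΦ := (hK.comp_absolutelyContinuousOnInterval hU).integral_deriv_eq_sub
  rw [hu t ⟨hs.trans hst, htT⟩, hu s ⟨hs, hst.trans htT⟩]
  refine hΦ.symm.trans (integral_congr_ae ?_)
  filter_upwards [hv.ae_hasDerivAt_integral] with σ hσ hσst
  have hσT := hst_sub (Set.uIoc_subset_uIcc hσst)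
  have hderiv : HasDerivAt U (v σ) σ := (hσ hσT 0 Set.left_mem_uIcc).const_add (u 0)
  rw [((hL.hasFDerivAt_integral_primitive hφ0 hM hψ (U σ)).comp_hasDerivAt σ hderiv).deriv,
    innerSL_apply_apply, L2.inner_def]
  rw [Set.uIcc_of_le hT.le] at hσT
  refine MeasureTheory.integral_congr_ae ?_
  filter_upwards [hL.coeFn_compLp hφ0 (U σ)] with x hx
  rw [hx, hu σ hσT]
  exact mul_comm _ _
end

section
/- Let (Ω, μ) be a finite measure space, T > 0, and let u ∈ H¹(0,T;L²(μ)) with time derivative v. Let φ : ℝ → ℝ be a non-decreasing, bounded, Lipschitz-continuous function with φ(0) = 0, and set ψ(s) = ∫₀ˢ φ(σ) dσ. Then the function t ↦ ∫_Ω ψ(u(t)) dμ is absolutely continuous on [0,T]. -/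
open MeasureTheory intervalIntegral

/-- `F` is absolutely continuous on the interval `[a, b]`: for every `ε > 0` there is
`δ > 0` such that for every finite family of pairwise disjoint subintervals
`(s i, t i)` of `[a, b]` of total length `< δ`, one has `∑ |F (t i) − F (s i)| < ε`. -/
def AbsolutelyContinuousOnIcc (F : ℝ → ℝ) (a b : ℝ) : Prop :=
  ∀ ε : ℝ, 0 < ε → ∃ δ : ℝ, 0 < δ ∧
    ∀ (n : ℕ) (s t : Fin n → ℝ),
      (∀ i, s i ∈ Set.Icc a b ∧ t i ∈ Set.Icc a b ∧ s i ≤ t i) →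
      (∀ i j, i ≠ j → Disjoint (Set.Ioo (s i) (t i)) (Set.Ioo (s j) (t j))) →
      (∑ i, (t i - s i)) < δ →
      (∑ i, |F (t i) - F (s i)|) < ε

/-- A function whose increments are controlled by the integral of a nonnegative integrable
function is absolutely continuous. -/
theorem absolutelyContinuousOnIcc_of_abs_sub_le_integral {F g : ℝ → ℝ} {a b : ℝ}
    (hg0 : ∀ x, 0 ≤ g x) (hg : IntegrableOn g (Set.Icc a b))
    (hF : ∀ s ∈ Set.Icc a b, ∀ t ∈ Set.Icc a b, s ≤ t → |F t - F s| ≤ ∫ x in s..t, g x) :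
    AbsolutelyContinuousOnIcc F a b := by
  intro ε hε
  obtain ⟨δ, hδ, hδε⟩ := exists_pos_setLIntegral_lt_of_measure_lt
    (μ := volume.restrict (Set.Icc a b)) (f := fun x => ‖g x‖ₑ) hg.2.ne
    (ε := ENNReal.ofReal ε) (by simpa using hε)
  obtain ⟨r, hr0, hrδ⟩ := ENNReal.lt_iff_exists_nnreal_btwn.1 hδ
  refine ⟨r, by exact_mod_cast hr0, fun n s t hst hdisj hsum => ?_⟩
  have hsub : ∀ i, Set.Ioo (s i) (t i) ⊆ Set.Icc a b := fun i x hx =>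
    ⟨(hst i).1.1.trans hx.1.le, hx.2.le.trans (hst i).2.1.2⟩
  have hUsub : (⋃ i, Set.Ioo (s i) (t i)) ⊆ Set.Icc a b := Set.iUnion_subset hsub
  have hvol : volume.restrict (Set.Icc a b) (⋃ i, Set.Ioo (s i) (t i)) < δ := by
    refine lt_of_le_of_lt ?_ hrδ
    calc volume.restrict (Set.Icc a b) (⋃ i, Set.Ioo (s i) (t i))
        ≤ volume (⋃ i, Set.Ioo (s i) (t i)) := Measure.restrict_apply_le _ _
      _ ≤ ∑ i, volume (Set.Ioo (s i) (t i)) := measure_iUnion_fintype_le _ _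
      _ = ENNReal.ofReal (∑ i, (t i - s i)) := by
          rw [ENNReal.ofReal_sum_of_nonneg fun i _ => sub_nonneg.2 (hst i).2.2]
          simp only [Real.volume_Ioo]
      _ ≤ r := by
          rw [← ENNReal.ofReal_coe_nnreal]
          exact ENNReal.ofReal_le_ofReal hsum.le
  have hlt := hδε _ hvol
  rw [Measure.restrict_restrict_of_subset hUsub] at hlt
  calc ∑ i, |F (t i) - F (s i)| ≤ ∑ i, ∫ x in Set.Ioo (s i) (t i), g x := by
        refine Finset.sum_le_sum fun i _ => ?_
        rw [← integral_Ioc_eq_integral_Ioo, ← intervalIntegral.integral_of_le (hst i).2.2]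
        exact hF _ (hst i).1 _ (hst i).2.1 (hst i).2.2
    _ = ∫ x in ⋃ i, Set.Ioo (s i) (t i), g x :=
        (integral_iUnion_fintype (fun i => measurableSet_Ioo) (fun i j hij => hdisj i j hij)
          fun i => hg.mono_set (hsub i)).symm
    _ = (∫⁻ x in ⋃ i, Set.Ioo (s i) (t i), ‖g x‖ₑ).toReal := by
        rw [← integral_norm_eq_lintegral_enorm (hg.mono_set hUsub).1]
        simp only [Real.norm_of_nonneg (hg0 _)]
    _ < ε := ENNReal.toReal_lt_of_lt_ofReal hlt

/-- On a finite measure space the `L¹` norm is controlled by the `L²` norm. -/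
theorem Lp_two_integral_norm_le {Ω : Type*} [MeasurableSpace Ω] (μ : Measure Ω)
    [IsFiniteMeasure μ] (w : Lp ℝ 2 μ) :
    ∫ x, ‖w x‖ ∂μ ≤ ‖w‖ * ((μ Set.univ) ^ (1 / 2 : ℝ)).toReal := by
  have h := eLpNorm_le_eLpNorm_mul_rpow_measure_univ (μ := μ) (p := 1) (q := 2)
    (by norm_num) (Lp.aestronglyMeasurable w)
  rw [integral_norm_eq_lintegral_enorm (Lp.aestronglyMeasurable w),
    ← eLpNorm_one_eq_lintegral_enorm, Lp.norm_def, ← ENNReal.toReal_mul]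
  refine ENNReal.toReal_mono (ENNReal.mul_ne_top (Lp.eLpNorm_ne_top w)
    (ENNReal.rpow_ne_top_of_nonneg (by norm_num) (measure_ne_top μ _))) ?_
  convert h using 3
  norm_num

/-- Integrating a Lipschitz function along `L²` functions gives a Lipschitz functional. -/
theorem abs_integral_comp_sub_le {Ω : Type*} [MeasurableSpace Ω] (μ : Measure Ω)
    [IsFiniteMeasure μ] {ψ : ℝ → ℝ} {K : NNReal} (hψ : LipschitzWith K ψ) (hψ0 : ψ 0 = 0)
    (f g : Lp ℝ 2 μ) :
    |∫ x, ψ (f x) ∂μ - ∫ x, ψ (g x) ∂μ| ≤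
      K * ((μ Set.univ) ^ (1 / 2 : ℝ)).toReal * ‖f - g‖ := by
  have hint : ∀ w : Lp ℝ 2 μ, Integrable (fun x => ψ (w x)) μ := fun w =>
    (hψ.comp_memLp hψ0 (Lp.memLp w)).integrable (by norm_num)
  have hfg : Integrable (fun x => ‖(f - g : Lp ℝ 2 μ) x‖) μ :=
    ((Lp.memLp (f - g)).integrable (by norm_num)).norm
  calc |∫ x, ψ (f x) ∂μ - ∫ x, ψ (g x) ∂μ|
      = ‖∫ x, (ψ (f x) - ψ (g x)) ∂μ‖ := by
        rw [integral_sub (hint f) (hint g), Real.norm_eq_abs]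
    _ ≤ ∫ x, K * ‖(f - g : Lp ℝ 2 μ) x‖ ∂μ := by
        refine norm_integral_le_of_norm_le (hfg.const_mul _) ?_
        filter_upwards [Lp.coeFn_sub f g] with x hx
        rw [hx]
        exact hψ.norm_sub_le _ _
    _ = K * ∫ x, ‖(f - g : Lp ℝ 2 μ) x‖ ∂μ := integral_const_mul _ _
    _ ≤ K * (‖f - g‖ * ((μ Set.univ) ^ (1 / 2 : ℝ)).toReal) := by
        gcongr
        exact Lp_two_integral_norm_le μ (f - g)
    _ = _ := by ring

/-- A primitive of a continuous bounded function is Lipschitz. -/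
theorem lipschitzWith_primitive {φ : ℝ → ℝ} (hφ : Continuous φ) {K : NNReal}
    (hK : ∀ s, |φ s| ≤ K) : LipschitzWith K fun s => ∫ σ in (0 : ℝ)..s, φ σ := by
  refine LipschitzWith.of_dist_le_mul fun a b => ?_
  rw [Real.dist_eq, Real.dist_eq, intervalIntegral.integral_interval_sub_left
    (hφ.intervalIntegrable _ _) (hφ.intervalIntegrable _ _), ← Real.norm_eq_abs]
  exact intervalIntegral.norm_integral_le_of_norm_le_const fun x _ => hK x

/-- Let `(Ω, μ)` be a finite measure space, `T > 0`, and
`u ∈ H¹(0,T;L²(μ))` with time derivative `v`. Let `φ : ℝ → ℝ` be non-decreasing,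
bounded, Lipschitz with `φ(0) = 0`, and `ψ(s) = ∫₀ˢ φ(σ) dσ`. Then
`t ↦ ∫ ψ(u(t)) dμ` is absolutely continuous on `[0, T]`. -/
theorem stmt2 {Ω : Type*} [MeasurableSpace Ω] (μ : Measure Ω) [IsFiniteMeasure μ]
    (T : ℝ) (hT : 0 < T)
    (u v : ℝ → Lp ℝ 2 μ)
    (hv_meas : StronglyMeasurable v)
    (hv_int : IntegrableOn (fun s => ‖v s‖ ^ 2) (Set.Icc 0 T))
    (hu : ∀ t ∈ Set.Icc (0:ℝ) T, u t = u 0 + ∫ s in (0:ℝ)..t, v s)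
    (φ ψ : ℝ → ℝ)
    (hφ_mono : Monotone φ) (hφ_bdd : ∃ M : ℝ, ∀ s : ℝ, |φ s| ≤ M)
    (hφ_lip : ∃ L : NNReal, LipschitzWith L φ) (hφ0 : φ 0 = 0)
    (hψ : ∀ s : ℝ, ψ s = ∫ σ in (0:ℝ)..s, φ σ) :
    AbsolutelyContinuousOnIcc (fun t => ∫ x, ψ (u t x) ∂μ) 0 T := by
  obtain ⟨M, hM⟩ := hφ_bdd
  obtain ⟨L, hL⟩ := hφ_lip
  have hψ_lip : LipschitzWith M.toNNReal ψ := by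
    rw [funext hψ]
    exact lipschitzWith_primitive hL.continuous fun s => (hM s).trans (Real.le_coe_toNNReal M)
  have hv : IntegrableOn v (Set.Icc 0 T) :=
    ((memLp_two_iff_integrable_sq_norm hv_meas.aestronglyMeasurable).2 hv_int).integrable
      (by norm_num)
  set C : ℝ := M.toNNReal * ((μ Set.univ) ^ (1 / 2 : ℝ)).toReal
  refine absolutelyContinuousOnIcc_of_abs_sub_le_integral (g := fun s => C * ‖v s‖)
    (fun s => by positivity) (hv.norm.const_mul C) fun s hs t ht hst => ?_
  have hint : ∀ r ∈ Set.Icc (0 : ℝ) T, IntervalIntegrable v volume 0 r := fun r hr =>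
    (intervalIntegrable_iff_integrableOn_Icc_of_le hr.1).2
      (hv.mono_set (Set.Icc_subset_Icc_right hr.2))
  have hsub : u t - u s = ∫ r in s..t, v r := by
    rw [hu t ht, hu s hs, add_sub_add_left_eq_sub,
      intervalIntegral.integral_interval_sub_left (hint t ht) (hint s hs)]
  calc |∫ x, ψ (u t x) ∂μ - ∫ x, ψ (u s x) ∂μ| ≤ C * ‖u t - u s‖ :=
        abs_integral_comp_sub_le μ hψ_lip (by simp [hψ]) _ _
    _ ≤ C * ∫ r in s..t, ‖v r‖ := by
        rw [hsub]
        gcongr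
        exact intervalIntegral.norm_integral_le_integral_norm hst
    _ = ∫ r in s..t, C * ‖v r‖ := (intervalIntegral.integral_const_mul _ _).symm
end

section
/- Let T > 0, r > 1, let y : [0,T] → [0,∞) be continuous, and let a : [0,T] → [0,∞) be integrable. If y(t)^r ≤ y(0)^r + r ∫₀ᵗ a(s) y(s)^{r−1} ds for every t ∈ [0,T], then y(t) ≤ y(0) + ∫₀ᵗ a(s) ds for every t ∈ [0,T]. -/
open MeasureTheory intervalIntegral

/-- The inequality half of the fundamental theorem of calculus for the monotone function
`t ↦ (c + ∫ s in 0..t, a s) ^ r`. -/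
theorem mul_integral_mul_rpow_le {r c t : ℝ} {a : ℝ → ℝ} (hr : 0 ≤ r) (hc : 0 < c) (ht : 0 ≤ t)
    (ha_nonneg : ∀ s ∈ Set.Icc 0 t, 0 ≤ a s) (ha : IntervalIntegrable a volume 0 t) :
    r * ∫ s in (0 : ℝ)..t, a s * (c + ∫ u in (0 : ℝ)..s, a u) ^ (r - 1) ≤
      (c + ∫ s in (0 : ℝ)..t, a s) ^ r - c ^ r := by
  have hmono : MonotoneOn (fun s => ∫ u in (0 : ℝ)..s, a u) (Set.Icc 0 t) := by
    intro s hs u hu hsu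
    refine integral_mono_interval le_rfl hs.1 hsu ?_
      (ha.mono_set (by rw [Set.uIcc_of_le hu.1, Set.uIcc_of_le ht]; gcongr; exact hu.2))
    refine (ae_restrict_iff' measurableSet_Ioc).2 (Filter.Eventually.of_forall fun v hv => ?_)
    exact ha_nonneg v ⟨hv.1.le, hv.2.trans hu.2⟩
  have hnonneg : ∀ s ∈ Set.Icc 0 t, 0 ≤ ∫ u in (0 : ℝ)..s, a u := fun s hs =>
    integral_nonneg hs.1 fun v hv => ha_nonneg v ⟨hv.1, hv.2.trans hs.2⟩
  set F : ℝ → ℝ := fun s => (c + ∫ u in (0 : ℝ)..s, a u) ^ r with hF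
  have hFmono : MonotoneOn F (Set.uIcc 0 t) := by
    rw [Set.uIcc_of_le ht]
    intro s hs u hu hsu
    exact Real.rpow_le_rpow (add_nonneg hc.le (hnonneg s hs))
      (add_le_add_right (hmono hs hu hsu) c) hr
  have hderiv : ∫ s in (0 : ℝ)..t, deriv F s =
      r * ∫ s in (0 : ℝ)..t, a s * (c + ∫ u in (0 : ℝ)..s, a u) ^ (r - 1) := by
    rw [← intervalIntegral.integral_const_mul]
    refine integral_congr_ae ?_
    filter_upwards [ha.ae_hasDerivAt_integral] with s hs hst
    have hs' := Set.uIoc_subset_uIcc hst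
    have hpos : c + ∫ u in (0 : ℝ)..s, a u ≠ 0 :=
      (add_pos_of_pos_of_nonneg hc (hnonneg s (by rwa [Set.uIcc_of_le ht] at hs'))).ne'
    rw [(((hs hs' 0 Set.left_mem_uIcc).const_add c).rpow_const (p := r) (Or.inl hpos)).deriv]
    ring
  have h0 : F 0 = c ^ r := by simp [hF]
  have hmem := hFmono.intervalIntegral_deriv_mem_uIcc
  rw [Set.uIcc_of_le (sub_nonneg.2 (hFmono Set.left_mem_uIcc Set.right_mem_uIcc ht)), hderiv,
    h0] at hmem
  exact hmem.2

/-- Bihari–Gronwall type inequality. Let `T > 0`, `r > 1`,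
`y : [0,T] → [0,∞)` continuous and `a : [0,T] → [0,∞)` integrable. If
`y(t)^r ≤ y(0)^r + r ∫₀ᵗ a(s) y(s)^{r−1} ds` for every `t ∈ [0,T]`, then
`y(t) ≤ y(0) + ∫₀ᵗ a(s) ds` for every `t ∈ [0,T]`. -/
theorem stmt9 (T r : ℝ) (hT : 0 < T) (hr : 1 < r)
    (y a : ℝ → ℝ)
    (hy_cont : ContinuousOn y (Set.Icc 0 T))
    (hy_nonneg : ∀ t ∈ Set.Icc (0:ℝ) T, 0 ≤ y t)
    (ha_nonneg : ∀ t ∈ Set.Icc (0:ℝ) T, 0 ≤ a t)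
    (ha_int : IntegrableOn a (Set.Icc 0 T))
    (h : ∀ t ∈ Set.Icc (0:ℝ) T,
      y t ^ r ≤ y 0 ^ r + r * ∫ s in (0:ℝ)..t, a s * y s ^ (r - 1)) :
    ∀ t ∈ Set.Icc (0:ℝ) T, y t ≤ y 0 + ∫ s in (0:ℝ)..t, a s := by
  intro t ht
  refine le_of_forall_pos_lt_add fun ε hε => ?_
  have ha : IntervalIntegrable a volume 0 T := by
    rwa [intervalIntegrable_iff_integrableOn_Icc_of_le hT.le]
  set Y : ℝ → ℝ := fun s => (y 0 + ε) + ∫ u in (0 : ℝ)..s, a u with hY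
  have hY_cont : ContinuousOn Y (Set.Icc 0 T) :=
    continuousOn_const.add <| by
      simpa only [Set.uIcc_of_le hT.le] using
        continuousOn_primitive_interval (a := 0) (b := T) (by rwa [Set.uIcc_of_le hT.le])
  have hc : 0 < y 0 + ε := add_pos_of_nonneg_of_pos (hy_nonneg 0 ⟨le_rfl, hT.le⟩) hε
  have hY_nonneg : ∀ s ∈ Set.Icc 0 T, 0 ≤ Y s := fun s hs =>
    add_nonneg hc.le (integral_nonneg hs.1 fun v hv => ha_nonneg v ⟨hv.1, hv.2.trans hs.2⟩)
  suffices hlt : ∀ s ∈ Set.Icc 0 T, y s < Y s by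
    have := hlt t ht
    simp only [hY] at this
    linarith
  by_contra! hne
  obtain ⟨t₁, ⟨ht₁, hle⟩, hmin⟩ :
      ∃ t₁, IsLeast {s ∈ Set.Icc 0 T | Y s ≤ y s} t₁ :=
    (isCompact_Icc.of_isClosed_subset (isClosed_Icc.isClosed_le hY_cont hy_cont)
      fun s hs => hs.1).exists_isLeast hne
  have hsub : Set.Icc 0 t₁ ⊆ Set.Icc 0 T := Set.Icc_subset_Icc_right ht₁.2
  have ha₁ : IntervalIntegrable a volume 0 t₁ :=
    ha.mono_set (by rwa [Set.uIcc_of_le ht₁.1, Set.uIcc_of_le hT.le])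
  have hint : ∀ f : ℝ → ℝ, ContinuousOn f (Set.Icc 0 T) →
      IntervalIntegrable (fun s => a s * f s ^ (r - 1)) volume 0 t₁ := fun f hf =>
    ha₁.mul_continuousOn <| by
      rw [Set.uIcc_of_le ht₁.1]
      exact (hf.mono hsub).rpow_const fun _ _ => Or.inr (by linarith)
  have hcompare : ∫ s in (0 : ℝ)..t₁, a s * y s ^ (r - 1) ≤
      ∫ s in (0 : ℝ)..t₁, a s * Y s ^ (r - 1) := by
    refine integral_mono_on_of_le_Ioo ht₁.1 (hint y hy_cont) (hint Y hY_cont) fun s hs => ?_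
    have hsT : s ∈ Set.Icc 0 T := hsub (Set.Ioo_subset_Icc_self hs)
    have hys : y s ≤ Y s := le_of_not_ge fun hle => (hmin ⟨hsT, hle⟩).not_gt hs.2
    exact mul_le_mul_of_nonneg_left
      (Real.rpow_le_rpow (hy_nonneg s hsT) hys (by linarith)) (ha_nonneg s hsT)
  have hFTC : r * ∫ s in (0 : ℝ)..t₁, a s * Y s ^ (r - 1) ≤ Y t₁ ^ r - (y 0 + ε) ^ r :=
    mul_integral_mul_rpow_le (by linarith) hc ht₁.1 (fun s hs => ha_nonneg s (hsub hs)) ha₁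
  have hstart : y 0 ^ r < (y 0 + ε) ^ r :=
    Real.rpow_lt_rpow (hy_nonneg 0 ⟨le_rfl, hT.le⟩) (by linarith) (by linarith)
  have hpow : Y t₁ ^ r ≤ y t₁ ^ r := Real.rpow_le_rpow (hY_nonneg t₁ ht₁) hle (by linarith)
  have hmul := mul_le_mul_of_nonneg_left hcompare (by linarith : 0 ≤ r)
  linarith [h t₁ ht₁]
end
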